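/- Let K, L ∈ ℕ with L > K, let α ∈ 𝒞_{K,L} with associated sequence (n_k), and let h(x) = -log x - log(1-x). There exists a constant C''' > 0 such that for every k ∈ ℕ, every s ∈ {1, …, q_{n_k}} and every b > 0: W_{k,s}(b + C''') ⊆ V_k^h(b) ∩ I_s ⊆ W_{k,s}(b − C'''), where I_s = (v_s, w_s) ranges over the intervals of the partition of 𝕋 by the points {−iα}_{i=0}^{q_{n_k}−1}, y_s is the midpoint of I_s, W_{k,s}(b) = {x ∈ I_s : |S_{q_{n_k}}(h)(x) − S_{q_{n_k}}(h)(y_s)| ≥ b}, and V_k^h(b) = {x ∈ 𝕋 : |S_{q_{n_k}}(h)(x) − c_k^h| ≥ b} with c_k^h = S_{q_{n_k}}(h)(1/(2q_{n_k})). -/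

import Mathlib

open MeasureTheory Filter Topology

noncomputable section

/-- Iterates of the Gauss map applied to the fractional part of `α`. -/
def gaussIter (α : ℝ) (n : ℕ) : ℝ := (fun x : ℝ => Int.fract x⁻¹)^[n] (Int.fract α)

/-- The `n`-th partial quotient `a_n` of the continued fraction expansion of `α`
(for `n ≥ 1`). -/
def cfA (α : ℝ) (n : ℕ) : ℕ := ⌊(gaussIter α (n - 1))⁻¹⌋₊

/-- The denominators `q_n` of the convergents of the continued fraction of `α`:
`q₀ = 1`, `q₁ = a₁`, `q_{n+1} = a_{n+1} q_n + q_{n-1}`. -/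
def cfQ (α : ℝ) : ℕ → ℕ
  | 0 => 1
  | 1 => cfA α 1
  | n + 2 => cfA α (n + 2) * cfQ α (n + 1) + cfQ α n

/-- Birkhoff sums over the rotation by `α`: `S_n(φ)(x) = ∑_{i<n} φ(x + iα)`. -/
def birkhoffRot (α : ℝ) (φ : ℝ → ℝ) (n : ℕ) (x : ℝ) : ℝ :=
  ∑ i ∈ Finset.range n, φ (x + i * α)

/-- Distance to the nearest integer, `‖x‖ = min(x mod 1, 1 - x mod 1)`. -/
def distNearestInt (x : ℝ) : ℝ := min (Int.fract x) (1 - Int.fract x)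

/-- `h(x) = -log x - log(1-x)`, read on the circle. -/
def symLog (x : ℝ) : ℝ := -Real.log (Int.fract x) - Real.log (1 - Int.fract x)

/-- The points `{-iα (mod 1)}_{0 ≤ i < q}` defining the partition of `𝕋 = [0,1)`. -/
def partPoints (α : ℝ) (q : ℕ) : Set ℝ :=
  (fun i : ℕ => Int.fract (-(i : ℝ) * α)) '' Set.Iio q

/-- `(v, w)` is one of the intervals of the partition of `𝕋 = [0,1)` by the points
`{-iα}_{0 ≤ i < q}`: `v` is a partition point, `w` is the next partition point
(or the endpoint `1`), and no partition point lies strictly between them. -/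
def IsPartitionInterval (α : ℝ) (q : ℕ) (v w : ℝ) : Prop :=
  v ∈ partPoints α q ∧ (w ∈ partPoints α q ∨ w = 1) ∧ v < w ∧
    ∀ p ∈ partPoints α q, ¬(v < p ∧ p < w)

lemma gaussIter_succ (α : ℝ) (n : ℕ) :
    gaussIter α (n + 1) = Int.fract (gaussIter α n)⁻¹ :=
  Function.iterate_succ_apply' _ _ _

lemma irrational_gaussIter {α : ℝ} (h : Irrational α) (n : ℕ) : Irrational (gaussIter α n) := by
  induction n with
  | zero => exact h.sub_intCast ⌊α⌋
  | succ n ih =>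
    rw [gaussIter_succ, Int.fract]
    exact ih.inv.sub_intCast _

lemma gaussIter_pos {α : ℝ} (h : Irrational α) (n : ℕ) : 0 < gaussIter α n := by
  refine lt_of_le_of_ne ?_ (irrational_gaussIter h n).ne_zero.symm
  cases n with
  | zero => exact Int.fract_nonneg _
  | succ n => rw [gaussIter_succ]; exact Int.fract_nonneg _

lemma gaussIter_lt_one (α : ℝ) (n : ℕ) : gaussIter α n < 1 := by
  cases n with
  | zero => exact Int.fract_lt_one _
  | succ n => rw [gaussIter_succ]; exact Int.fract_lt_one _

lemma inv_gaussIter {α : ℝ} (h : Irrational α) (n : ℕ) :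
    (gaussIter α n)⁻¹ = cfA α (n + 1) + gaussIter α (n + 1) := by
  have h0 : 0 ≤ (gaussIter α n)⁻¹ := (inv_pos.2 (gaussIter_pos h n)).le
  rw [gaussIter_succ, cfA, Nat.add_sub_cancel, natCast_floor_eq_intCast_floor h0]
  exact (Int.floor_add_fract _).symm

lemma one_le_cfA {α : ℝ} (h : Irrational α) (n : ℕ) : 1 ≤ cfA α (n + 1) := by
  rw [cfA, Nat.add_sub_cancel, Nat.one_le_floor_iff, one_le_inv₀ (gaussIter_pos h n)]
  exact (gaussIter_lt_one α n).le

/-- Numerators of the convergents of the continued fraction of `α`. -/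
def cfP (α : ℝ) : ℕ → ℤ
  | 0 => 0
  | 1 => 1
  | n + 2 => cfA α (n + 2) * cfP α (n + 1) + cfP α n

/-- The signed error `q_n α - p_n`. -/
def cfD (α : ℝ) (n : ℕ) : ℝ := cfQ α n * α - cfP α n

lemma cfD_succ {α : ℝ} (h : Irrational α) (hα : α ∈ Set.Ioo (0 : ℝ) 1) (n : ℕ) :
    cfD α (n + 1) = -gaussIter α (n + 1) * cfD α n := by
  induction n with
  | zero =>
    have h0 : gaussIter α 0 = α := Int.fract_eq_self.2 ⟨hα.1.le, hα.2⟩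
    have h1 := inv_gaussIter h 0
    rw [h0] at h1
    have h2 : gaussIter α (0 + 1) = α⁻¹ - cfA α (0 + 1) := by linarith
    have h3 : α ≠ 0 := hα.1.ne'
    rw [h2]
    simp only [cfD, cfQ, cfP, zero_add]
    push_cast
    field_simp
    ring
  | succ n ih =>
    have h1 := inv_gaussIter h (n + 1)
    have h2 := (gaussIter_pos h (n + 1)).ne'
    have h3 : cfD α (n + 2) = cfA α (n + 2) * cfD α (n + 1) + cfD α n := by
      simp only [cfD, cfQ, cfP]
      push_cast
      ring
    have h4 : cfD α n = -(gaussIter α (n + 1))⁻¹ * cfD α (n + 1) := by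
      rw [ih]; field_simp
    rw [h3, h4, h1]
    ring

lemma cfP_mul_cfQ_sub (α : ℝ) (n : ℕ) :
    cfP α (n + 1) * cfQ α n - cfP α n * cfQ α (n + 1) = (-1) ^ n := by
  induction n with
  | zero => simp [cfP, cfQ]
  | succ n ih =>
    rw [pow_succ, ← ih]
    simp only [cfP, cfQ]
    push_cast
    ring

lemma cfQ_pos {α : ℝ} (h : Irrational α) (n : ℕ) : 0 < cfQ α n := by
  induction n using Nat.twoStepInduction with
  | zero => simp [cfQ]
  | one => exact one_le_cfA h 0
  | more n _ ih =>
    have := one_le_cfA h (n + 1)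
    rw [cfQ]
    positivity

lemma cfA_mul_cfQ_le (α : ℝ) (n : ℕ) : cfA α (n + 1) * cfQ α n ≤ cfQ α (n + 1) := by
  cases n <;> simp [cfQ]

lemma cfQ_le_succ {α : ℝ} (h : Irrational α) (n : ℕ) : cfQ α n ≤ cfQ α (n + 1) :=
  (Nat.le_mul_of_pos_left _ (one_le_cfA h n)).trans (cfA_mul_cfQ_le α n)

lemma cfQ_succ_le {α : ℝ} (h : Irrational α) (n : ℕ) :
    cfQ α (n + 1) ≤ (cfA α (n + 1) + 1) * cfQ α n := by
  cases n with
  | zero => simp [cfQ]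
  | succ n =>
    have := cfQ_le_succ h n
    rw [cfQ]
    linarith

lemma cfQ_mul_abs_cfD_add {α : ℝ} (h : Irrational α) (hα : α ∈ Set.Ioo (0 : ℝ) 1) (n : ℕ) :
    cfQ α (n + 1) * |cfD α n| + cfQ α n * |cfD α (n + 1)| = 1 := by
  have h1 : (cfQ α (n + 1) : ℝ) * cfD α n - cfQ α n * cfD α (n + 1) = (-1) ^ n := by
    have := cfP_mul_cfQ_sub α n
    have h2 : (cfP α (n + 1) * cfQ α n - cfP α n * cfQ α (n + 1) : ℝ) = (-1) ^ n := by
      exact_mod_cast this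
    rw [← h2, cfD, cfD]
    ring
  have h3 : (cfQ α (n + 1) : ℝ) * cfD α n - cfQ α n * cfD α (n + 1)
      = (cfQ α (n + 1) + cfQ α n * gaussIter α (n + 1)) * cfD α n := by
    rw [cfD_succ h hα]; ring
  have hg := gaussIter_pos h (n + 1)
  have h4 : |(cfQ α (n + 1) + cfQ α n * gaussIter α (n + 1)) * cfD α n| = 1 := by
    rw [← h3, h1]; simp
  rw [abs_mul, abs_of_nonneg (by positivity)] at h4
  rw [cfD_succ h hα, abs_mul, abs_neg, abs_of_pos hg]
  linarith

lemma abs_cfD_le {α : ℝ} (h : Irrational α) (hα : α ∈ Set.Ioo (0 : ℝ) 1) (n : ℕ) :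
    |cfD α n| ≤ 1 / cfQ α (n + 1) := by
  have h1 := cfQ_mul_abs_cfD_add h hα n
  have h2 : (0 : ℝ) < cfQ α (n + 1) := by exact_mod_cast cfQ_pos h (n + 1)
  rw [le_div_iff₀ h2]
  nlinarith [show (0 : ℝ) ≤ cfQ α n * |cfD α (n + 1)| by positivity]

lemma abs_cfD_le_inv_cfQ {α : ℝ} (h : Irrational α) (hα : α ∈ Set.Ioo (0 : ℝ) 1) (n : ℕ) :
    |cfD α n| ≤ 1 / cfQ α n := by
  refine (abs_cfD_le h hα n).trans (one_div_le_one_div_of_le ?_ ?_)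
  · exact_mod_cast cfQ_pos h n
  · exact_mod_cast cfQ_le_succ h n

lemma le_abs_cfD {α : ℝ} (h : Irrational α) (hα : α ∈ Set.Ioo (0 : ℝ) 1) (n : ℕ) :
    1 / (2 * cfQ α (n + 1)) ≤ |cfD α n| := by
  have h1 := cfQ_mul_abs_cfD_add h hα n
  have h2 : (0 : ℝ) < cfQ α (n + 1) := by exact_mod_cast cfQ_pos h (n + 1)
  have h3 : (cfQ α n : ℝ) ≤ cfQ α (n + 1) := by exact_mod_cast cfQ_le_succ h n
  have h4 : |cfD α (n + 1)| ≤ |cfD α n| := by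
    rw [cfD_succ h hα, abs_mul, abs_neg, abs_of_pos (gaussIter_pos h _)]
    exact mul_le_of_le_one_left (abs_nonneg _) (gaussIter_lt_one _ _).le
  rw [div_le_iff₀ (by positivity)]
  nlinarith [mul_le_mul h3 h4 (abs_nonneg _) h2.le]

lemma isCoprime_cfP_cfQ (α : ℝ) (n : ℕ) : IsCoprime (cfP α n) (cfQ α n : ℤ) := by
  refine ⟨-(-1) ^ n * cfQ α (n + 1), (-1) ^ n * cfP α (n + 1), ?_⟩
  have h1 := cfP_mul_cfQ_sub α n
  have h2 : ((-1 : ℤ) ^ n) * (-1) ^ n = 1 := by rw [← mul_pow]; simp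
  linear_combination (-1) ^ n * h1 + h2

/-- Best approximation: multiples of `α` up to order `q_n` are `1 / (2 q_n)`-separated from the
integers. -/
lemma le_abs_mul_sub_intCast {α : ℝ} (h : Irrational α) (hα : α ∈ Set.Ioo (0 : ℝ) 1) {n : ℕ}
    {i : ℤ} (hi0 : i ≠ 0) (hi : |i| < cfQ α n) (z : ℤ) :
    1 / (2 * cfQ α n) ≤ |i * α - z| := by
  cases n with
  | zero =>
    simp only [cfQ] at hi
    exact absurd (abs_lt.1 hi) (by push_cast; omega)
  | succ n =>
    refine (le_abs_cfD h hα n).trans ?_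
    set e : ℤ := (-1) ^ n with he
    have he2 : e * e = 1 := by rw [he, ← mul_pow]; simp
    have hdet : cfP α (n + 1) * cfQ α n - cfP α n * cfQ α (n + 1) = e := cfP_mul_cfQ_sub α n
    set u : ℤ := e * (i * cfP α (n + 1) - z * cfQ α (n + 1)) with hu
    set v : ℤ := e * (z * cfQ α n - i * cfP α n) with hv
    have h1 : i = u * cfQ α n + v * cfQ α (n + 1) := by
      rw [hu, hv]; linear_combination (-i * e) * hdet - i * he2
    have h2 : z = u * cfP α n + v * cfP α (n + 1) := by
      rw [hu, hv]; linear_combination (-z * e) * hdet - z * he2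
    have h3 : (i : ℝ) * α - z = (u - v * gaussIter α (n + 1)) * cfD α n := by
      have h4 : (i : ℝ) * α - z = u * cfD α n + v * cfD α (n + 1) := by
        rw [h1, h2, cfD, cfD]; push_cast; ring
      rw [h4, cfD_succ h hα]; ring
    rw [h3, abs_mul]
    refine le_mul_of_one_le_left (abs_nonneg _) ?_
    have hg0 := gaussIter_pos h (n + 1)
    have hq0 : (0 : ℤ) < cfQ α n := by exact_mod_cast cfQ_pos h n
    have hq1 : (0 : ℤ) < cfQ α (n + 1) := by exact_mod_cast cfQ_pos h (n + 1)
    have hi' := abs_lt.1 hi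
    have hu0 : u ≠ 0 := by
      intro h0
      rw [h0, zero_mul, zero_add] at h1
      have hv0 : v ≠ 0 := by rintro h0'; simp [h0'] at h1; exact hi0 h1
      rcases lt_or_gt_of_ne hv0 with hlt | hgt
      · nlinarith
      · nlinarith
    rcases lt_or_gt_of_ne hu0 with hlt | hgt
    · have hv0 : 0 ≤ v := by
        by_contra! hneg
        nlinarith
      have : (u : ℝ) ≤ -1 := by exact_mod_cast (by omega : u ≤ -1)
      have : (0 : ℝ) ≤ v := by exact_mod_cast hv0
      rw [abs_of_nonpos (by nlinarith)]
      nlinarith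
    · have hv0 : v ≤ 0 := by
        by_contra! hneg
        nlinarith
      have : (1 : ℝ) ≤ u := by exact_mod_cast (by omega : 1 ≤ u)
      have : (v : ℝ) ≤ 0 := by exact_mod_cast hv0
      rw [abs_of_nonneg (by nlinarith)]
      nlinarith

/-- Sums of `q_j` weighted by the distance to the last index are controlled by the last term. -/
lemma sum_cfQ_le {α : ℝ} (h : Irrational α) (n : ℕ) :
    ∑ j ∈ Finset.range n, (cfQ α (j + 1) : ℝ) ≤ 3 * cfQ α n := by
  have key : ∀ n, ∑ j ∈ Finset.range (n + 1), (cfQ α (j + 1) : ℝ)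
      ≤ 2 * cfQ α (n + 1) + cfQ α n := by
    intro n
    induction n with
    | zero =>
      have : (0 : ℝ) ≤ cfQ α 0 := by positivity
      have : (0 : ℝ) ≤ cfQ α 1 := by positivity
      simp only [zero_add, Finset.sum_range_one]
      linarith
    | succ n ih =>
      rw [Finset.sum_range_succ]
      have h1 : cfQ α (n + 1) + cfQ α n ≤ cfQ α (n + 2) := by
        have := Nat.le_mul_of_pos_left (cfQ α (n + 1)) (one_le_cfA h (n + 1))
        rw [cfQ]
        lia
      have h2 : (cfQ α (n + 1) + cfQ α n : ℝ) ≤ cfQ α (n + 2) := by exact_mod_cast h1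
      linarith
  cases n with
  | zero => simp
  | succ n =>
    have h1 : (cfQ α n : ℝ) ≤ cfQ α (n + 1) := by exact_mod_cast cfQ_le_succ h n
    linarith [key n]

lemma sum_cfQ_mul_le {α : ℝ} (h : Irrational α) (n : ℕ) :
    ∑ j ∈ Finset.range n, (cfQ α (j + 1) : ℝ) * (n - j) ≤ 9 * cfQ α n := by
  have key : ∀ n : ℕ, ∑ j ∈ Finset.range n, (cfQ α (j + 1) : ℝ) * (n - j)
      ≤ 3 * ∑ j ∈ Finset.range n, (cfQ α (j + 1) : ℝ) := by
    intro n
    induction n with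
    | zero => simp
    | succ n ih =>
      have h1 : ∑ j ∈ Finset.range (n + 1), (cfQ α (j + 1) : ℝ) * ((n + 1 : ℕ) - j)
          = ∑ j ∈ Finset.range n, (cfQ α (j + 1) : ℝ) * (n - j)
            + ∑ j ∈ Finset.range (n + 1), (cfQ α (j + 1) : ℝ) := by
        rw [Finset.sum_range_succ, Finset.sum_range_succ, ← add_assoc, ← Finset.sum_add_distrib]
        push_cast
        congr 1
        · exact Finset.sum_congr rfl fun j _ => by ring
        · ring
      have h2 := sum_cfQ_le h (n + 1)
      rw [h1, Finset.sum_range_succ _ n, mul_add]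
      rw [Finset.sum_range_succ] at h2
      linarith
  linarith [key n, sum_cfQ_le h n]

/-- The points `x + i p / q`, `i < q`, are, modulo `1`, the points `(j + {q x}) / q`, `j < q`. -/
lemma exists_rearrangement {q : ℕ} (hq : 0 < q) {p : ℤ} (hpq : IsCoprime p (q : ℤ)) (x : ℝ) :
    ∃ κ : ℕ → ℕ, Set.BijOn κ (Finset.range q) (Finset.range q) ∧
      ∀ i, ∃ z : ℤ, x + i * (p / q) = (κ i + Int.fract (q * x)) / q + z := by
  have hq' : (0 : ℤ) < q := by exact_mod_cast hq
  have hqr : (q : ℝ) ≠ 0 := by positivity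
  have hκ : ∀ i : ℕ, (((⌊q * x⌋ + i * p) % q).toNat : ℤ) = (⌊q * x⌋ + i * p) % q := fun i =>
    Int.toNat_of_nonneg (Int.emod_nonneg _ hq'.ne')
  have hmaps : Set.MapsTo (fun i : ℕ => ((⌊q * x⌋ + i * p) % q).toNat)
      (Finset.range q) (Finset.range q) := by
    intro i _
    have := Int.emod_lt_of_pos (⌊q * x⌋ + i * p) hq'
    have := hκ i
    simp only [Finset.coe_range, Set.mem_Iio]
    omega
  have hinj : Set.InjOn (fun i : ℕ => ((⌊q * x⌋ + i * p) % q).toNat) (Finset.range q) := by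
    intro i hi j hj hij
    simp only [Finset.coe_range, Set.mem_Iio] at hi hj hij
    have h1 : (⌊q * x⌋ + i * p) % q = (⌊q * x⌋ + j * p) % q := by
      rw [← hκ i, ← hκ j, hij]
    have h2 := Int.ModEq.dvd h1
    have h3 : (q : ℤ) ∣ ((j : ℤ) - i) * p := by
      convert h2 using 1; ring
    have h4 := hpq.symm.dvd_of_dvd_mul_right h3
    have h5 := Int.eq_zero_of_abs_lt_dvd h4 (by rw [abs_lt]; omega)
    omega
  refine ⟨fun i => ((⌊q * x⌋ + i * p) % q).toNat,
    ⟨hmaps, hinj, Finset.surjOn_of_injOn_of_card_le _ hmaps hinj le_rfl⟩, fun i => ?_⟩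
  refine ⟨(⌊q * x⌋ + i * p) / q, ?_⟩
  have h1 := Int.emod_add_mul_ediv (⌊q * x⌋ + i * p) q
  rw [← hκ i] at h1
  have h2 : ((((⌊q * x⌋ + i * p) % q).toNat : ℕ) : ℝ)
      + q * (((⌊q * x⌋ + i * p) / q : ℤ) : ℝ) = ⌊q * x⌋ + i * p := by exact_mod_cast h1
  have h3 := Int.floor_add_fract ((q : ℝ) * x)
  generalize ((((⌊q * x⌋ + i * p) % q).toNat : ℕ) : ℝ) = k at *
  generalize (((⌊q * x⌋ + i * p) / q : ℤ) : ℝ) = w at *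
  generalize Int.fract ((q : ℝ) * x) = f at *
  field_simp
  linarith

lemma exists_rearrangement_rotation {α : ℝ} {q : ℕ} (hq : 0 < q) {p : ℤ}
    (hpq : IsCoprime p (q : ℤ)) (hα : |q * α - p| ≤ 1 / q) (x : ℝ) :
    ∃ κ : ℕ → ℕ, Set.BijOn κ (Finset.range q) (Finset.range q) ∧
      ∀ i < q, ∃ z : ℤ, (κ i - 1 : ℝ) / q < x + i * α - z ∧ x + i * α - z < (κ i + 2 : ℝ) / q := by
  obtain ⟨κ, hbij, hκ⟩ := exists_rearrangement hq hpq x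
  refine ⟨κ, hbij, fun i hi => ?_⟩
  obtain ⟨z, hz⟩ := hκ i
  have hqr : (0 : ℝ) < q := by exact_mod_cast hq
  have hir : (i : ℝ) < q := by exact_mod_cast hi
  have hi0 : (0 : ℝ) ≤ i := by positivity
  have h1 : |(i : ℝ) * (q * α - p)| < 1 := by
    rw [abs_mul, abs_of_nonneg hi0]
    calc (i : ℝ) * |q * α - p| ≤ i * (1 / q) := by gcongr
      _ < 1 := by rw [mul_one_div, div_lt_one hqr]; exact hir
  have h2 : x + i * α - z = (κ i + Int.fract (q * x) + i * (q * α - p)) / q := by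
    have h3 : x + i * α - z = (x + i * (p / q)) - z + i * (q * α - p) / q := by
      field_simp; ring
    rw [h3, hz]; ring
  have h4 := abs_lt.1 h1
  have h5 := Int.fract_nonneg ((q : ℝ) * x)
  have h6 := Int.fract_lt_one ((q : ℝ) * x)
  refine ⟨z, ?_, ?_⟩
  · rw [h2]
    exact div_lt_div_of_pos_right (by linarith) hqr
  · rw [h2]
    exact div_lt_div_of_pos_right (by linarith) hqr

/-- The derivative of `symLog` away from the integers. -/
def symLogDeriv (x : ℝ) : ℝ := 1 / (1 - Int.fract x) - 1 / Int.fract x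

lemma sum_range_inv_pred_sub_le (q : ℕ) :
    ∑ k ∈ Finset.range q, (1 / ((k - 1 : ℕ) : ℝ) - 1 / (k + 2)) ≤ 1 := by
  have key : ∀ k : ℕ, ∑ j ∈ Finset.range (k + 2), (1 / ((j - 1 : ℕ) : ℝ) - 1 / (j + 2))
      = 1 - 1 / (k + 1) - 1 / (k + 2) - 1 / (k + 3) := by
    intro k
    induction k with
    | zero => norm_num [Finset.sum_range_succ]
    | succ k ih =>
      rw [Finset.sum_range_succ, ih]
      have : k + 2 - 1 = k + 1 := by omega
      rw [this]
      push_cast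
      ring
  rcases q with _ | _ | k
  · simp
  · norm_num
  · rw [key]
    have : (0 : ℝ) ≤ 1 / (k + 1) + 1 / (k + 2) + 1 / (k + 3) := by positivity
    linarith

/-- One-sided Denjoy–Koksma type bound for `symLogDeriv`, up to the closest visit to the
singularity. -/
lemma exists_birkhoffRot_symLogDeriv_le {α : ℝ} {q : ℕ} (hq : 0 < q) {p : ℤ}
    (hpq : IsCoprime p (q : ℤ)) (hα : |q * α - p| ≤ 1 / q) (x : ℝ) :
    ∃ i < q, birkhoffRot α symLogDeriv q x ≤ 3 / (1 - Int.fract (x + i * α)) + 4 * q := by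
  obtain ⟨κ, hbij, hκ⟩ := exists_rearrangement_rotation hq hpq hα x
  obtain ⟨i₀, hi₀, hmax⟩ := Finset.exists_max_image (Finset.range q)
    (fun i : ℕ => 1 / (1 - Int.fract (x + i * α))) ⟨0, by simpa using hq⟩
  refine ⟨i₀, by simpa using hi₀, ?_⟩
  set R : ℝ := 1 / (1 - Int.fract (x + i₀ * α)) with hR
  have hqr : (0 : ℝ) < q := by exact_mod_cast hq
  have hR0 : 0 ≤ R := one_div_nonneg.2 (by linarith [Int.fract_lt_one (x + i₀ * α)])
  set g : ℕ → ℝ := fun k => (if k = 0 then R + q else 0) + (if k = q - 2 then R + q else 0)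
    + (if k = q - 1 then R + q else 0) + q * (1 / ((q - 1 - k - 1 : ℕ) : ℝ) - 1 / (k + 2)) with hg
  have hterm : ∀ i ∈ Finset.range q, symLogDeriv (x + i * α) ≤ g (κ i) := by
    intro i hi
    have hRi := hmax i hi
    have hkq := hbij.mapsTo hi
    rw [Finset.mem_range] at hi
    simp only [Finset.coe_range, Set.mem_Iio] at hkq
    obtain ⟨z, hz1, hz2⟩ := hκ i hi
    generalize κ i = k at *
    have hf0 := Int.fract_nonneg (x + i * α)
    have hf1 := Int.fract_lt_one (x + i * α)
    have hA : (0 : ℝ) ≤ q * (1 / ((q - 1 - k - 1 : ℕ) : ℝ)) := by positivity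
    have hB : (q : ℝ) * (1 / (k + 2)) ≤ q :=
      mul_le_of_le_one_right hqr.le (by
        rw [div_le_one (by positivity)]
        linarith [k.cast_nonneg (α := ℝ)])
    have hind : ∀ P : Prop, [Decidable P] → (0 : ℝ) ≤ if P then R + q else 0 := by
      intro P _; split_ifs <;> positivity
    by_cases hk : k = 0 ∨ k = q - 2 ∨ k = q - 1
    · have h1 : symLogDeriv (x + i * α) ≤ R := by
        have : (0 : ℝ) ≤ 1 / Int.fract (x + i * α) := one_div_nonneg.2 hf0
        rw [symLogDeriv]
        linarith
      have h2 : R + q ≤ (if k = 0 then R + q else 0) + (if k = q - 2 then R + q else 0)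
          + (if k = q - 1 then R + q else 0) := by
        have a1 := hind (k = 0)
        have a2 := hind (k = q - 2)
        have a3 := hind (k = q - 1)
        rcases hk with hk | hk | hk
        · rw [if_pos hk] at a1 ⊢; linarith
        · rw [if_pos hk] at a2 ⊢; linarith
        · rw [if_pos hk] at a3 ⊢; linarith
      simp only [hg]
      rw [mul_sub]
      linarith
    · have hk1 : 1 ≤ k := by omega
      have hk2 : k + 2 < q := by omega
      have hk1r : (1 : ℝ) ≤ k := by exact_mod_cast hk1
      have hk2r : (k + 2 : ℝ) < q := by exact_mod_cast hk2
      have hfr : Int.fract (x + i * α) = x + i * α - z := by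
        rw [Int.fract_eq_iff]
        refine ⟨le_trans (div_nonneg (by linarith) hqr.le) hz1.le, hz2.trans ?_, z, by ring⟩
        rw [div_lt_one hqr]; exact hk2r
      have hfp : 0 < Int.fract (x + i * α) := by
        rw [hfr]; exact lt_of_le_of_lt (div_nonneg (by linarith) hqr.le) hz1
      have h1 : (q : ℝ) * (1 / (k + 2)) ≤ 1 / Int.fract (x + i * α) := by
        rw [mul_one_div, div_le_div_iff₀ (by positivity) hfp, hfr]
        rw [lt_div_iff₀ hqr] at hz2
        linarith
      have hsub : ((q - 1 - k - 1 : ℕ) : ℝ) = q - k - 2 := by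
        rw [show q - 1 - k - 1 = q - (k + 2) by omega, Nat.cast_sub hk2.le]
        push_cast; ring
      have h2 : 1 / (1 - Int.fract (x + i * α)) ≤ q * (1 / ((q - 1 - k - 1 : ℕ) : ℝ)) := by
        rw [mul_one_div, div_le_div_iff₀ (by linarith) (by rw [hsub]; linarith), hsub, hfr]
        rw [lt_div_iff₀ hqr] at hz2
        linarith
      have a1 := hind (k = 0)
      have a2 := hind (k = q - 2)
      have a3 := hind (k = q - 1)
      simp only [hg, symLogDeriv]
      rw [mul_sub]
      linarith
  have hsum : ∑ i ∈ Finset.range q, g (κ i) = ∑ k ∈ Finset.range q, g k :=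
    Finset.sum_nbij κ (fun i hi => hbij.mapsTo hi) hbij.injOn hbij.surjOn fun _ _ => rfl
  have hind : ∀ a : ℕ, ∑ k ∈ Finset.range q, (if k = a then R + q else 0) ≤ R + q := by
    intro a
    rw [Finset.sum_ite_eq']
    split_ifs
    · exact le_rfl
    · positivity
  calc birkhoffRot α symLogDeriv q x ≤ ∑ i ∈ Finset.range q, g (κ i) := Finset.sum_le_sum hterm
    _ = ∑ k ∈ Finset.range q, g k := hsum
    _ ≤ (R + q) + (R + q) + (R + q) + q * 1 := by
      simp only [hg]
      rw [Finset.sum_add_distrib, Finset.sum_add_distrib, Finset.sum_add_distrib,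
        ← Finset.mul_sum]
      refine add_le_add (add_le_add (add_le_add (hind _) (hind _)) (hind _)) ?_
      refine mul_le_mul_of_nonneg_left ?_ hqr.le
      rw [Finset.sum_sub_distrib,
        Finset.sum_range_reflect (fun k => 1 / ((k - 1 : ℕ) : ℝ)) q, ← Finset.sum_sub_distrib]
      exact sum_range_inv_pred_sub_le q
    _ = 3 / (1 - Int.fract (x + i₀ * α)) + 4 * q := by rw [hR]; ring

/-- A sum of inverses over an `s`-separated set of positive reals. -/
lemma exists_sum_inv_le_of_separated {ι : Type*} (J : Finset ι) {f : ι → ℝ}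
    {s : ℝ} (hs : 0 < s) (hf : ∀ i ∈ J, 0 < f i)
    (hsep : ∀ i ∈ J, ∀ j ∈ J, i ≠ j → s ≤ |f i - f j|) (hJ : J.Nonempty) :
    ∃ i ∈ J, ∑ j ∈ J, 1 / f j ≤ 1 / f i + harmonic (J.card - 1) / s := by
  classical
  suffices H : J.Nonempty → (∀ i ∈ J, 0 < f i) →
      (∀ i ∈ J, ∀ j ∈ J, i ≠ j → s ≤ |f i - f j|) →
      (∃ i ∈ J, ∑ j ∈ J, 1 / f j ≤ 1 / f i + harmonic (J.card - 1) / s) ∧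
      ∃ j ∈ J, ((J.card - 1 : ℕ) : ℝ) * s ≤ f j from (H hJ hf hsep).1
  clear hf hsep hJ
  induction J using Finset.induction_on_max_value f with
  | empty => intro h; exact absurd h (by simp)
  | insert a J haJ hmax ih =>
    intro _ hf hsep
    rcases J.eq_empty_or_nonempty with rfl | hJ
    · refine ⟨⟨a, by simp, by simp⟩, a, by simp, ?_⟩
      simpa using (hf a (by simp)).le
    · obtain ⟨⟨i, hi, hsum⟩, j, hj, hle⟩ := ih hJ
        (fun i hi => hf i (Finset.mem_insert_of_mem hi))
        (fun i hi j hj => hsep i (Finset.mem_insert_of_mem hi) j (Finset.mem_insert_of_mem hj))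
      have hpos : 0 < f a := hf a (Finset.mem_insert_self _ _)
      have hcard : 0 < J.card := hJ.card_pos
      have h1 : (J.card : ℝ) * s ≤ f a := by
        have h2 := hsep a (Finset.mem_insert_self _ _) j (Finset.mem_insert_of_mem hj)
          (by rintro rfl; exact haJ hj)
        rw [abs_of_nonneg (by linarith [hmax j hj])] at h2
        rw [Nat.cast_sub hcard] at hle
        push_cast at hle
        linarith
      have hc : (insert a J).card - 1 = J.card - 1 + 1 := by
        rw [Finset.card_insert_of_notMem haJ]; omega
      have hc' : J.card - 1 + 1 = J.card := by omega
      refine ⟨⟨i, Finset.mem_insert_of_mem hi, ?_⟩, a, Finset.mem_insert_self _ _, ?_⟩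
      · rw [Finset.sum_insert haJ, hc, harmonic_succ, hc']
        have h3 : 1 / f a ≤ 1 / (J.card * s) := by
          apply one_div_le_one_div_of_le _ h1
          positivity
        push_cast
        rw [add_div]
        have h4 : (J.card : ℝ)⁻¹ / s = 1 / (J.card * s) := by field_simp
        linarith
      · rw [hc, hc']; exact h1

lemma birkhoffRot_add (α : ℝ) (φ : ℝ → ℝ) (m n : ℕ) (x : ℝ) :
    birkhoffRot α φ (m + n) x = birkhoffRot α φ m x + birkhoffRot α φ n (x + m * α) := by
  simp only [birkhoffRot, Finset.sum_range_add]
  congr 1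
  refine Finset.sum_congr rfl fun i _ => ?_
  push_cast
  ring_nf

/-- Splitting an orbit segment into blocks of length `q`, keeping one closest visit per block. -/
lemma exists_finset_birkhoffRot_symLogDeriv_le {α : ℝ} {q : ℕ} {B : ℝ} (hB : 0 ≤ B)
    (hblock : ∀ x, ∃ i < q,
      birkhoffRot α symLogDeriv q x ≤ 3 / (1 - Int.fract (x + i * α)) + 4 * q)
    (hshort : ∀ N, 0 < N → N < q → ∀ x, ∃ i < N,
      birkhoffRot α symLogDeriv N x ≤ 3 / (1 - Int.fract (x + i * α)) + B)
    {r : ℕ} (hr : r < q) (b : ℕ) (x : ℝ) :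
    ∃ J ⊆ Finset.range (r + b * q), J.card ≤ b + 1 ∧
      birkhoffRot α symLogDeriv (r + b * q) x
        ≤ ∑ i ∈ J, 3 / (1 - Int.fract (x + i * α)) + b * (4 * q) + B := by
  induction b with
  | zero =>
    rcases Nat.eq_zero_or_pos r with rfl | hr0
    · exact ⟨∅, by simp, by simp, by simpa [birkhoffRot] using hB⟩
    · obtain ⟨i, hi, hle⟩ := hshort r hr0 hr x
      exact ⟨{i}, by simpa using hi, by simp, by simpa using hle⟩
  | succ b ih =>
    obtain ⟨J, hJ, hcard, hle⟩ := ih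
    set N := r + b * q with hN
    obtain ⟨i, hi, hle'⟩ := hblock (x + N * α)
    have hNq : r + (b + 1) * q = N + q := by rw [hN]; ring
    have hnot : N + i ∉ J := fun hmem => by
      have := Finset.mem_range.1 (hJ hmem)
      omega
    refine ⟨insert (N + i) J, ?_, ?_, ?_⟩
    · intro j hj
      rw [Finset.mem_range, hNq]
      rcases Finset.mem_insert.1 hj with rfl | hj
      · omega
      · have := Finset.mem_range.1 (hJ hj)
        omega
    · rw [Finset.card_insert_of_notMem hnot]; omega
    · rw [hNq, birkhoffRot_add, Finset.sum_insert hnot]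
      have hx : x + N * α + i * α = x + ((N + i : ℕ) : ℝ) * α := by push_cast; ring
      rw [hx] at hle'
      push_cast at hle' ⊢
      linarith

lemma le_abs_fract_sub_fract {α : ℝ} (h : Irrational α) (hα : α ∈ Set.Ioo (0 : ℝ) 1) {n : ℕ}
    {i j : ℕ} (hi : i < cfQ α n) (hj : j < cfQ α n) (hij : i ≠ j) (x : ℝ) :
    1 / (2 * cfQ α n) ≤ |(1 - Int.fract (x + i * α)) - (1 - Int.fract (x + j * α))| := by
  have h1 := le_abs_mul_sub_intCast h hα (n := n) (i := (j : ℤ) - i) (by omega)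
    (by rw [abs_lt]; omega) (⌊x + j * α⌋ - ⌊x + i * α⌋)
  convert h1 using 2
  simp only [Int.fract]
  push_cast
  ring

/-- One-sided bound for short Birkhoff sums of `symLogDeriv`, up to the closest visit. -/
lemma exists_birkhoffRot_symLogDeriv_le_of_lt {α : ℝ} (h : Irrational α)
    (hα : α ∈ Set.Ioo (0 : ℝ) 1) (n : ℕ) : ∀ N, 0 < N → N < cfQ α n → ∀ x, ∃ i < N,
      birkhoffRot α symLogDeriv N x ≤ 3 / (1 - Int.fract (x + i * α))
        + ∑ j ∈ Finset.range n, (cfQ α (j + 1) : ℝ) * (10 + 6 * Real.log (cfA α (j + 1))) := by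
  have hlog : ∀ j, 0 ≤ Real.log (cfA α j) := fun j => Real.log_natCast_nonneg _
  induction n with
  | zero => intro N h0 h1; simp only [cfQ] at h1; omega
  | succ n ih =>
    intro N hN0 hN x
    have hq := cfQ_pos h n
    set B := ∑ j ∈ Finset.range n, (cfQ α (j + 1) : ℝ) * (10 + 6 * Real.log (cfA α (j + 1)))
      with hB
    have hB0 : 0 ≤ B := Finset.sum_nonneg fun j _ => by
      have := hlog (j + 1)
      positivity
    obtain ⟨J, hJ, hcard, hle⟩ := exists_finset_birkhoffRot_symLogDeriv_le hB0
      (exists_birkhoffRot_symLogDeriv_le hq (isCoprime_cfP_cfQ α n) (abs_cfD_le_inv_cfQ h hα n))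
      ih (Nat.mod_lt N hq) (N / cfQ α n) x
    rw [Nat.mod_add_div' N (cfQ α n)] at hJ hle
    set b := N / cfQ α n with hb
    have hba : b ≤ cfA α (n + 1) := by
      have h1 := hN.trans_le (cfQ_succ_le h n)
      exact Nat.lt_succ_iff.1 (Nat.div_lt_of_lt_mul (by rwa [mul_comm]))
    have hbq : (b : ℝ) * cfQ α n ≤ cfQ α (n + 1) := by
      exact_mod_cast (Nat.div_mul_le_self N (cfQ α n)).trans hN.le
    have hq1 : (0 : ℝ) < cfQ α (n + 1) := by exact_mod_cast cfQ_pos h (n + 1)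
    have hfpos : ∀ i : ℕ, 0 < 1 - Int.fract (x + i * α) := fun i => by
      linarith [Int.fract_lt_one (x + i * α)]
    rw [Finset.sum_range_succ]
    have hpos : 0 ≤ Real.log (cfA α (n + 1)) := hlog _
    rcases J.eq_empty_or_nonempty with rfl | hne
    · refine ⟨0, hN0, hle.trans ?_⟩
      have := div_nonneg (zero_le_three (α := ℝ)) (hfpos 0).le
      rw [Finset.sum_empty]
      nlinarith
    · obtain ⟨i, hi, hsum⟩ := exists_sum_inv_le_of_separated J
        (f := fun i : ℕ => 1 - Int.fract (x + i * α)) (s := 1 / (2 * cfQ α (n + 1)))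
        (by positivity) (fun i _ => hfpos i)
        (fun i hi j hj hij => le_abs_fract_sub_fract h hα ((Finset.mem_range.1 (hJ hi)).trans hN)
          ((Finset.mem_range.1 (hJ hj)).trans hN) hij x) hne
      refine ⟨i, Finset.mem_range.1 (hJ hi), hle.trans ?_⟩
      have h1 : ∑ i ∈ J, 3 / (1 - Int.fract (x + i * α))
          = 3 * ∑ i ∈ J, 1 / (1 - Int.fract (x + i * α)) := by
        rw [Finset.mul_sum]
        exact Finset.sum_congr rfl fun _ _ => by ring
      have h2 : (harmonic (J.card - 1) : ℝ) ≤ 1 + Real.log (cfA α (n + 1)) := by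
        refine (harmonic_le_one_add_log _).trans ?_
        rcases Nat.eq_zero_or_pos (J.card - 1) with h0 | h0
        · rw [h0]; simpa using hpos
        · gcongr
          exact_mod_cast (by omega : J.card - 1 ≤ b).trans hba
      have h3 : (harmonic (J.card - 1) : ℝ) / (1 / (2 * cfQ α (n + 1)))
          ≤ (1 + Real.log (cfA α (n + 1))) * (2 * cfQ α (n + 1)) := by
        rw [div_div_eq_mul_div, div_one]
        gcongr
      rw [h1]
      have h4 : 3 / (1 - Int.fract (x + i * α)) = 3 * (1 / (1 - Int.fract (x + i * α))) := by ring
      rw [h4]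
      nlinarith

lemma symLogDeriv_neg {x : ℝ} (hx : Int.fract x ≠ 0) : symLogDeriv (-x) = -symLogDeriv x := by
  rw [symLogDeriv, symLogDeriv, Int.fract_neg hx]
  ring

/-- A one-sided bound at all points upgrades to a two-sided bound away from the singularity. -/
lemma abs_birkhoffRot_symLogDeriv_le {α : ℝ} {N : ℕ} {B : ℝ} (hone : ∀ x, ∃ i < N,
      birkhoffRot α symLogDeriv N x ≤ 3 / (1 - Int.fract (x + i * α)) + B)
    {σ : ℝ} (hσ : 0 < σ) {x : ℝ}
    (hx : ∀ i < N, σ ≤ Int.fract (x + i * α) ∧ Int.fract (x + i * α) ≤ 1 - σ) :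
    |birkhoffRot α symLogDeriv N x| ≤ 3 / σ + B := by
  rw [abs_le']
  constructor
  · obtain ⟨i, hi, hle⟩ := hone x
    have h1 : 3 / (1 - Int.fract (x + i * α)) ≤ 3 / σ := by
      have := (hx i hi).2
      gcongr
      linarith
    linarith
  · obtain ⟨i, hi, hle⟩ := hone (-(x + (N - 1 : ℕ) * α))
    have hrefl : ∀ j < N, -(x + (N - 1 : ℕ) * α) + j * α = -(x + (N - 1 - j : ℕ) * α) := by
      intro j hj
      have h1 : ((N - 1 : ℕ) : ℝ) = (N - 1 - j : ℕ) + j := by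
        exact_mod_cast (by omega : N - 1 = N - 1 - j + j)
      rw [h1]; ring
    have hne : ∀ j < N, Int.fract (x + j * α) ≠ 0 := fun j hj => (hσ.trans_le (hx j hj).1).ne'
    have h1 : birkhoffRot α symLogDeriv N (-(x + (N - 1 : ℕ) * α))
        = -birkhoffRot α symLogDeriv N x := by
      simp only [birkhoffRot]
      rw [← Finset.sum_range_reflect (fun j : ℕ => symLogDeriv (x + j * α)),
        ← Finset.sum_neg_distrib]
      refine Finset.sum_congr rfl fun j hj => ?_
      rw [Finset.mem_range] at hj
      rw [hrefl j hj, symLogDeriv_neg (hne _ (by omega))]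
    have h2 := hx (N - 1 - i) (by omega)
    rw [h1, hrefl i hi, Int.fract_neg (hne _ (by omega)), sub_sub_cancel] at hle
    have h3 : 3 / Int.fract (x + (N - 1 - i : ℕ) * α) ≤ 3 / σ := by
      gcongr
      exact h2.1
    linarith

lemma hasDerivAt_symLog {x : ℝ} (hx : Int.fract x ≠ 0) :
    HasDerivAt symLog (symLogDeriv x) x := by
  have h0 : 0 < Int.fract x := lt_of_le_of_ne (Int.fract_nonneg x) hx.symm
  have h1 := Int.fract_lt_one x
  have hid : HasDerivAt (fun z : ℝ => z - ⌊x⌋) 1 x := (hasDerivAt_id x).sub_const _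
  have hlog := (hid.log (by exact hx)).neg.sub
    ((hid.const_sub 1).log (show 1 - (x - ⌊x⌋) ≠ 0 from (sub_pos.2 h1).ne'))
  have hder : HasDerivAt (fun z : ℝ => -Real.log (z - ⌊x⌋) - Real.log (1 - (z - ⌊x⌋)))
      (symLogDeriv x) x := by
    refine hlog.congr_deriv ?_
    rw [symLogDeriv, Int.fract]
    ring
  refine hder.congr_of_eventuallyEq ?_
  have hmem : Set.Ioo (⌊x⌋ : ℝ) (⌊x⌋ + 1) ∈ 𝓝 x := by
    refine Ioo_mem_nhds ?_ (Int.lt_floor_add_one x)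
    rw [Int.fract] at h0
    linarith
  filter_upwards [hmem] with z hz
  have hfl : ⌊z⌋ = ⌊x⌋ := Int.floor_eq_iff.2 ⟨hz.1.le, hz.2⟩
  simp only [symLog, Int.fract, hfl]

lemma abs_birkhoffRot_symLog_sub_le {α : ℝ} {N : ℕ} {M a b : ℝ}
    (hne : ∀ t ∈ Set.uIcc a b, ∀ i < N, Int.fract (t + i * α) ≠ 0)
    (hM : ∀ t ∈ Set.uIcc a b, |birkhoffRot α symLogDeriv N t| ≤ M) :
    |birkhoffRot α symLog N b - birkhoffRot α symLog N a| ≤ M * |b - a| := by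
  have hd : ∀ t ∈ Set.uIcc a b, HasDerivWithinAt (birkhoffRot α symLog N)
      (birkhoffRot α symLogDeriv N t) (Set.uIcc a b) t := by
    intro t ht
    refine HasDerivAt.hasDerivWithinAt (HasDerivAt.fun_sum fun i hi => ?_)
    exact (hasDerivAt_symLog (hne t ht i (Finset.mem_range.1 hi))).comp_add_const t _
  exact (convex_uIcc a b).norm_image_sub_le_of_norm_hasDerivWithin_le hd hM
    Set.left_mem_uIcc Set.right_mem_uIcc

lemma birkhoffRot_symLog_add_intCast (α : ℝ) (N : ℕ) (x : ℝ) (z : ℤ) :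
    birkhoffRot α symLog N (x + z) = birkhoffRot α symLog N x := by
  refine Finset.sum_congr rfl fun i _ => ?_
  rw [add_right_comm, symLog, symLog, Int.fract_add_intCast]

lemma IsPartitionInterval.exists_eq {α : ℝ} {q : ℕ} {v w : ℝ} (hvw : IsPartitionInterval α q v w) :
    0 ≤ v ∧ w ≤ 1 ∧ (∃ i < q, ∃ z : ℤ, v = z - i * α) ∧ ∃ j < q, ∃ z : ℤ, w = z - j * α := by
  obtain ⟨⟨i, hi, rfl⟩, hw, -, -⟩ := hvw
  have hrep : ∀ j : ℕ, ∃ z : ℤ, Int.fract (-(j : ℝ) * α) = z - j * α := fun j =>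
    ⟨-⌊-(j : ℝ) * α⌋, by rw [Int.fract]; push_cast; ring⟩
  refine ⟨Int.fract_nonneg _, ?_, ⟨i, hi, hrep i⟩, ?_⟩
  · rcases hw with ⟨j, -, rfl⟩ | rfl
    · exact (Int.fract_lt_one _).le
    · exact le_rfl
  · rcases hw with ⟨j, hj, rfl⟩ | rfl
    · exact ⟨j, hj, hrep j⟩
    · exact ⟨0, (Nat.zero_le i).trans_lt hi, 1, by simp⟩

/-- Points well inside a partition interval have orbits staying away from the integers. -/
lemma IsPartitionInterval.fract_mem_Icc {α : ℝ} {q : ℕ} {v w : ℝ}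
    (hvw : IsPartitionInterval α q v w) {σ : ℝ} (hσ : 0 < σ) {t : ℝ}
    (ht : t ∈ Set.Icc (v + σ) (w - σ)) {l : ℕ} (hl : l < q) :
    σ ≤ Int.fract (t + l * α) ∧ Int.fract (t + l * α) ≤ 1 - σ := by
  obtain ⟨hv, hw, -, -⟩ := hvw.exists_eq
  obtain ⟨ht1, ht2⟩ := ht
  set p := Int.fract (-(l : ℝ) * α) with hp
  have hp0 : 0 ≤ p := Int.fract_nonneg _
  have hp1 : p < 1 := Int.fract_lt_one _
  have hpz : t + l * α = t - p - ⌊-(l : ℝ) * α⌋ := by rw [hp, Int.fract]; ring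
  rw [hpz, Int.fract_sub_intCast]
  rcases le_or_gt p v with h | h
  · have hfr : Int.fract (t - p) = t - p := Int.fract_eq_self.2 ⟨by linarith, by linarith⟩
    rw [hfr]
    constructor <;> linarith
  · have h' : w ≤ p := not_lt.1 fun hlt => hvw.2.2.2 p ⟨l, hl, rfl⟩ ⟨h, hlt⟩
    have hfr : Int.fract (t - p) = t - p + 1 :=
      Int.fract_eq_iff.2 ⟨by linarith, by linarith, -1, by push_cast; ring⟩
    rw [hfr]
    constructor <;> linarith

lemma IsPartitionInterval.sub_le {α : ℝ} {q : ℕ} (hq : 0 < q) {p : ℤ}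
    (hpq : IsCoprime p (q : ℤ)) (hα : |q * α - p| ≤ 1 / q) {v w : ℝ}
    (hvw : IsPartitionInterval α q v w) : (w - v) / 2 ≤ 2 / q := by
  have hlt := hvw.2.2.1
  have hqr : (0 : ℝ) < q := by exact_mod_cast hq
  obtain ⟨κ, hbij, hκ⟩ := exists_rearrangement_rotation hq hpq hα ((v + w) / 2)
  obtain ⟨i, hi, hi0⟩ := hbij.surjOn (show 0 ∈ (Finset.range q : Set ℕ) by simpa using hq)
  have hi' : i < q := by simpa using hi
  obtain ⟨z, hz1, hz2⟩ := hκ i hi'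
  obtain ⟨hf1, hf2⟩ := hvw.fract_mem_Icc (σ := (w - v) / 2) (t := (v + w) / 2) (by linarith)
    ⟨by linarith, by linarith⟩ hi'
  rw [hi0] at hz1 hz2
  have hfl := Int.floor_add_fract ((v + w) / 2 + i * α)
  set f := Int.fract ((v + w) / 2 + i * α)
  set m := ⌊(v + w) / 2 + i * α⌋
  have h1 : ((0 : ℕ) - 1 : ℝ) / q = -(1 / q) := by push_cast; ring
  have h2 : ((0 : ℕ) + 2 : ℝ) / q = 2 * (1 / q) := by push_cast; ring
  have h3 : (0 : ℝ) < 1 / q := by positivity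
  rw [h1] at hz1
  rw [h2] at hz2
  have h4 : (2 : ℝ) / q = 2 * (1 / q) := by ring
  rw [h4]
  rcases le_or_gt z m with h | h
  · have : (z : ℝ) ≤ m := by exact_mod_cast h
    linarith
  · have : (m + 1 : ℝ) ≤ z := by exact_mod_cast h
    linarith

lemma IsPartitionInterval.le_sub {α : ℝ} (h : Irrational α) (hα : α ∈ Set.Ioo (0 : ℝ) 1) {n : ℕ}
    {v w : ℝ} (hvw : IsPartitionInterval α (cfQ α n) v w) : 1 / (2 * cfQ α n) ≤ w - v := by
  obtain ⟨-, -, ⟨i, hi, z, rfl⟩, j, hj, z', rfl⟩ := hvw.exists_eq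
  have hlt := hvw.2.2.1
  have hq : (1 : ℝ) ≤ cfQ α n := by exact_mod_cast cfQ_pos h n
  by_cases hij : i = j
  · subst hij
    have h1 : (z : ℝ) < z' := by linarith
    have h2 : (z + 1 : ℝ) ≤ z' := by exact_mod_cast h1
    have h3 : (1 : ℝ) / (2 * cfQ α n) ≤ 1 := by
      rw [div_le_one (by positivity)]; linarith
    linarith
  · have h1 := le_abs_mul_sub_intCast h hα (n := n) (i := (i : ℤ) - j) (by omega)
      (by rw [abs_lt]; omega) (z - z')
    have h2 : (((i : ℤ) - j : ℤ) : ℝ) * α - (z - z' : ℤ) = z' - j * α - (z - i * α) := by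
      push_cast; ring
    rwa [h2, abs_of_pos (by linarith)] at h1

/-- When `α` is very close to `p / q`, the orbit of `1 / (2q)` stays away from the integers. -/
lemma fract_half_add_mem_Icc {α : ℝ} {q : ℕ} (hq : 0 < q) {p : ℤ}
    (hα : |q * α - p| ≤ 1 / (100 * q)) {l : ℤ} (hl : |l| ≤ q) {e : ℝ}
    (he : |e| ≤ 1 / (100 * q)) :
    1 / (4 * q) ≤ Int.fract (1 / (2 * q) + l * α + e) ∧
      Int.fract (1 / (2 * q) + l * α + e) ≤ 1 - 1 / (4 * q) := by
  have hq' : (0 : ℤ) < q := by exact_mod_cast hq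
  have hqr : (0 : ℝ) < q := by exact_mod_cast hq
  have hr0 := Int.emod_nonneg (l * p) hq'.ne'
  have hr1 := Int.emod_lt_of_pos (l * p) hq'
  have hdiv := Int.emod_add_mul_ediv (l * p) q
  set r := l * p % q
  set d := l * p / q
  have hr0' : (0 : ℝ) ≤ r := by exact_mod_cast hr0
  have hr1' : (r + 1 : ℝ) ≤ q := by exact_mod_cast hr1
  have hdiv' : (r + q * d : ℝ) = l * p := by exact_mod_cast hdiv
  set u : ℝ := 1 / q with hu
  have hu0 : 0 < u := by positivity
  have hqu : q * u = 1 := by rw [hu]; field_simp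
  have hl' : |(l : ℝ)| ≤ q := by exact_mod_cast hl
  have h100 : 1 / (100 * (q : ℝ)) = u / 100 := by rw [hu]; field_simp
  have h4 : 1 / (4 * (q : ℝ)) = u / 4 := by rw [hu]; field_simp
  have h2 : 1 / (2 * (q : ℝ)) = u / 2 := by rw [hu]; field_simp
  rw [h100] at hα he
  rw [h4, h2]
  have herr : |l * u * (q * α - p)| ≤ u / 100 := by
    rw [abs_mul, abs_mul, abs_of_pos hu0]
    calc |(l : ℝ)| * u * |q * α - p| ≤ q * u * (u / 100) := by gcongr
      _ = u / 100 := by rw [hqu, one_mul]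
  have hval : u / 2 + l * α + e - d = r * u + u / 2 + l * u * (q * α - p) + e := by
    linear_combination (-l * α + d) * hqu - u * hdiv'
  have he' := abs_le.1 he
  have herr' := abs_le.1 herr
  have hru : 0 ≤ r * u := by positivity
  have hru' : r * u + u ≤ 1 := by nlinarith
  have hfr : Int.fract (u / 2 + l * α + e) = u / 2 + l * α + e - d :=
    Int.fract_eq_iff.2 ⟨by linarith, by linarith, d, by ring⟩
  rw [hfr]
  constructor <;> linarith

/-- Birkhoff sums of `symLog` at two points of the orbit segment of `1 / (2 q_n)` of length `q_n`
differ by a bounded amount. -/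
lemma abs_birkhoffRot_symLog_orbit_sub_le {α : ℝ} {n : ℕ} (h : Irrational α) {B : ℝ} (hB : 0 ≤ B)
    (hD : |cfD α n| ≤ 1 / (100 * cfQ α n))
    (hone : ∀ N, 0 < N → N < cfQ α n → ∀ x, ∃ i < N,
      birkhoffRot α symLogDeriv N x ≤ 3 / (1 - Int.fract (x + i * α)) + B * cfQ α n)
    {i : ℕ} (hi : i < cfQ α n) :
    |birkhoffRot α symLog (cfQ α n) (1 / (2 * cfQ α n) - i * α)
      - birkhoffRot α symLog (cfQ α n) (1 / (2 * cfQ α n))| ≤ 12 + B := by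
  rcases Nat.eq_zero_or_pos i with rfl | hi0
  · simpa using by linarith
  have hq := cfQ_pos h n
  set q := cfQ α n with hqdef
  have hqr : (0 : ℝ) < q := by exact_mod_cast hq
  set a : ℝ := 1 / (2 * q) - i * α with ha
  have hcocycle : birkhoffRot α symLog q a - birkhoffRot α symLog q (1 / (2 * q))
      = -(birkhoffRot α symLog i (a + cfD α n) - birkhoffRot α symLog i a) := by
    have h1 := birkhoffRot_add α symLog i q a
    have h2 := birkhoffRot_add α symLog q i a
    have h3 : a + i * α = 1 / (2 * q) := by rw [ha]; ring
    have h4 : a + q * α = a + cfD α n + cfP α n := by rw [cfD]; ring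
    rw [h3] at h1
    rw [h4, birkhoffRot_symLog_add_intCast, add_comm q i] at h2
    linarith
  have hfr : ∀ t ∈ Set.uIcc a (a + cfD α n), ∀ l < i,
      1 / (4 * (q : ℝ)) ≤ Int.fract (t + l * α) ∧
        Int.fract (t + l * α) ≤ 1 - 1 / (4 * (q : ℝ)) := by
    intro t ht l hl
    have he : |t - a| ≤ 1 / (100 * q) := by
      have := Set.abs_sub_left_of_mem_uIcc ht
      rw [add_sub_cancel_left] at this
      exact this.trans hD
    have h1 := fract_half_add_mem_Icc hq hD (l := (l : ℤ) - i) (by rw [abs_le]; omega) he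
    have h2 : t + l * α = 1 / (2 * q) + ((l : ℤ) - i : ℤ) * α + (t - a) := by
      rw [ha]; push_cast; ring
    rwa [h2]
  have hσ : 0 < 1 / (4 * (q : ℝ)) := by positivity
  have hmvt := abs_birkhoffRot_symLog_sub_le (α := α) (N := i) (M := (12 + B) * q)
    (fun t ht l hl => (hσ.trans_le (hfr t ht l hl).1).ne')
    (fun t ht => (abs_birkhoffRot_symLogDeriv_le (hone i hi0 hi) hσ (hfr t ht)).trans_eq (by
      rw [div_div_eq_mul_div]; ring))
  rw [hcocycle, abs_neg]
  refine hmvt.trans ?_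
  rw [add_sub_cancel_left]
  calc (12 + B) * q * |cfD α n| ≤ (12 + B) * q * (1 / (100 * q)) := by gcongr
    _ = (12 + B) / 100 := by field_simp
    _ ≤ 12 + B := by linarith

/-- The Birkhoff sum of `symLog` at the midpoint of a partition interval is uniformly close to its
value at `1 / (2 q_n)`. -/
lemma abs_birkhoffRot_symLog_midpoint_sub_le {α : ℝ} {n : ℕ} (h : Irrational α)
    (hα : α ∈ Set.Ioo (0 : ℝ) 1) {B : ℝ} (hB : 0 ≤ B)
    (hD : |cfD α n| ≤ 1 / (100 * cfQ α n))
    (hone : ∀ N, 0 < N → N < cfQ α n → ∀ x, ∃ i < N,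
      birkhoffRot α symLogDeriv N x ≤ 3 / (1 - Int.fract (x + i * α)) + B * cfQ α n)
    {v w : ℝ} (hvw : IsPartitionInterval α (cfQ α n) v w) :
    |birkhoffRot α symLog (cfQ α n) ((v + w) / 2)
      - birkhoffRot α symLog (cfQ α n) (1 / (2 * cfQ α n))| ≤ 44 + B := by
  have hq := cfQ_pos h n
  have hqr : (0 : ℝ) < cfQ α n := by exact_mod_cast hq
  have hD' := abs_cfD_le_inv_cfQ h hα n
  have hlow := hvw.le_sub h hα
  have hup := hvw.sub_le hq (isCoprime_cfP_cfQ α n) hD'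
  obtain ⟨hv0, hw1, ⟨i, hi, z, hv⟩, j, hj, z', hw⟩ := hvw.exists_eq
  have horbit := abs_birkhoffRot_symLog_orbit_sub_le h hB hD hone hi
  set q := cfQ α n with hqdef
  set σ : ℝ := 1 / (4 * q) with hσdef
  have hσ : 0 < σ := by positivity
  have h2σ : 1 / (2 * (q : ℝ)) = 2 * σ := by rw [hσdef]; field_simp; norm_num
  have h8σ : 2 / (q : ℝ) = 8 * σ := by rw [hσdef]; field_simp; norm_num
  have hy : v + 1 / (2 * q) = 1 / (2 * q) - i * α + z := by rw [hv]; ring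
  have hyw : v + 1 / (2 * q) ≤ w - σ := by
    obtain ⟨h1, h2⟩ := fract_half_add_mem_Icc hq hD (l := (j : ℤ) - i) (by rw [abs_le]; omega)
      (e := 0) (by rw [abs_zero]; positivity)
    have h3 : 1 / (2 * q) + (((j : ℤ) - i : ℤ) : ℝ) * α + 0
        = v + 1 / (2 * q) - w + ((z' - z : ℤ) : ℝ) := by
      rw [hv, hw]; push_cast; ring
    rw [h3, Int.fract_add_intCast] at h1 h2
    have hne : v + 1 / (2 * q) - w ≠ 0 := by
      intro h0
      rw [h0, Int.fract_zero] at h1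
      linarith
    have hneg : v + 1 / (2 * q) - w < 0 := lt_of_le_of_ne (by linarith) hne
    have hfr : Int.fract (v + 1 / (2 * q) - w) = v + 1 / (2 * q) - w + 1 := by
      refine Int.fract_eq_iff.2 ⟨?_, by linarith, -1, by push_cast; ring⟩
      linarith
    rw [hfr] at h2
    linarith
  rw [h2σ] at hy hyw hlow horbit ⊢
  rw [h8σ] at hup
  have hsub : Set.uIcc (v + 2 * σ) ((v + w) / 2) ⊆ Set.Icc (v + σ) (w - σ) :=
    Set.uIcc_subset_Icc ⟨by linarith, by linarith⟩ ⟨by linarith, by linarith⟩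
  have hmvt := abs_birkhoffRot_symLog_sub_le (α := α) (N := q) (M := 16 * q)
    (a := v + 2 * σ) (b := (v + w) / 2)
    (fun t ht l hl => (hσ.trans_le (hvw.fract_mem_Icc hσ (hsub ht) hl).1).ne')
    (fun t ht => (abs_birkhoffRot_symLogDeriv_le
      (exists_birkhoffRot_symLogDeriv_le hq (isCoprime_cfP_cfQ α n) hD') hσ
      (fun l hl => hvw.fract_mem_Icc hσ (hsub ht) hl)).trans_eq (by
        rw [hσdef, div_div_eq_mul_div]; ring))
  have hlen : |(v + w) / 2 - (v + 2 * σ)| ≤ 8 * σ := by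
    rw [abs_le]
    constructor <;> linarith
  have h32 : 16 * (q : ℝ) * (8 * σ) = 32 := by rw [hσdef]; field_simp; norm_num
  have hmvt' := hmvt.trans (mul_le_mul_of_nonneg_left hlen (by positivity))
  rw [h32, hy, birkhoffRot_symLog_add_intCast] at hmvt'
  have htri := abs_sub_le (birkhoffRot α symLog q ((v + w) / 2))
    (birkhoffRot α symLog q (2 * σ - i * α)) (birkhoffRot α symLog q (2 * σ))
  linarith

/-- Claim B. For `α ∈ 𝒞_{K,L}` (`L > K`) with associated sequence
`(n_k)` and `h(x) = -log x - log(1-x)`: there exists `C''' > 0` such that for every `k`,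
every partition interval `I_s = (v_s, w_s)` of `𝕋` by `{-iα}_{i<q_{n_k}}` and every
`b > 0`: `W_{k,s}(b + C''') ⊆ V_k^h(b) ∩ I_s ⊆ W_{k,s}(b - C''')`, where
`W_{k,s}(b) = {x ∈ I_s : |S_{q_{n_k}}(h)(x) - S_{q_{n_k}}(h)(y_s)| ≥ b}` (`y_s` the
midpoint of `I_s`) and `V_k^h(b) = {x ∈ 𝕋 : |S_{q_{n_k}}(h)(x) - c_k^h| ≥ b}` with
`c_k^h = S_{q_{n_k}}(h)(1/(2q_{n_k}))`. -/
theorem statement15 (K L : ℕ) (hKL : K < L)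
    (α : ℝ) (hirr : Irrational α) (hα : α ∈ Set.Ioo (0 : ℝ) 1)
    (nk : ℕ → ℕ) (hnk : StrictMono nk) (c : ℝ) (hc : 0 < c)
    (hdio1 : ∀ k n : ℕ, 1 ≤ n → n ≤ nk k →
      (cfA α (nk k + 1 - n) : ℝ) ≤ Real.exp (c * n))
    (hdio2 : ∀ k : ℕ, 100 * (K ^ 2 + L ^ 2) < cfA α (nk k + 1) ∧
      cfA α (nk k + 1) < 200 * (K ^ 2 + L ^ 2)) :
    ∃ C3 > (0 : ℝ), ∀ k : ℕ, ∀ v w : ℝ,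
      IsPartitionInterval α (cfQ α (nk k)) v w →
      ∀ b > (0 : ℝ),
        ({x ∈ Set.Ioo v w |
            b + C3 ≤ |birkhoffRot α symLog (cfQ α (nk k)) x
                  - birkhoffRot α symLog (cfQ α (nk k)) ((v + w) / 2)|}
          ⊆ {x ∈ Set.Ico (0 : ℝ) 1 |
              b ≤ |birkhoffRot α symLog (cfQ α (nk k)) x
                    - birkhoffRot α symLog (cfQ α (nk k))
                        (1 / (2 * (cfQ α (nk k) : ℝ)))|} ∩ Set.Ioo v w) ∧
        ({x ∈ Set.Ico (0 : ℝ) 1 |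
            b ≤ |birkhoffRot α symLog (cfQ α (nk k)) x
                  - birkhoffRot α symLog (cfQ α (nk k))
                      (1 / (2 * (cfQ α (nk k) : ℝ)))|} ∩ Set.Ioo v w
          ⊆ {x ∈ Set.Ioo v w |
              b - C3 ≤ |birkhoffRot α symLog (cfQ α (nk k)) x
                    - birkhoffRot α symLog (cfQ α (nk k)) ((v + w) / 2)|}) := by
  have hmid : ∀ k v w, IsPartitionInterval α (cfQ α (nk k)) v w →
      |birkhoffRot α symLog (cfQ α (nk k)) ((v + w) / 2)
        - birkhoffRot α symLog (cfQ α (nk k)) (1 / (2 * (cfQ α (nk k) : ℝ)))|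
        ≤ 44 + (30 + 54 * c) := by
    intro k v w hvw
    set n := nk k with hn
    refine abs_birkhoffRot_symLog_midpoint_sub_le hirr hα (by positivity) ?_ ?_ hvw
    · have hL : 1 ≤ K ^ 2 + L ^ 2 := by nlinarith
      have h1 : 100 ≤ cfA α (n + 1) := by
        have h0 := (hdio2 k).1
        rw [← hn] at h0
        omega
      have h2 : 100 * cfQ α n ≤ cfQ α (n + 1) :=
        (Nat.mul_le_mul_right _ h1).trans (cfA_mul_cfQ_le α n)
      have h3 := cfQ_pos hirr n
      refine (abs_cfD_le hirr hα n).trans (one_div_le_one_div_of_le (by positivity) ?_)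
      exact_mod_cast h2
    · intro N hN0 hN x
      obtain ⟨i, hi, hle⟩ := exists_birkhoffRot_symLogDeriv_le_of_lt hirr hα n N hN0 hN x
      refine ⟨i, hi, hle.trans (add_le_add_right ?_ _)⟩
      have hlog : ∀ j ∈ Finset.range n, Real.log (cfA α (j + 1)) ≤ c * (n - j) := by
        intro j hj
        rw [Finset.mem_range] at hj
        have h1 := hdio1 k (n - j) (by omega) (by omega)
        rw [← hn, show n + 1 - (n - j) = j + 1 by omega, Nat.cast_sub hj.le] at h1
        have h2 : (0 : ℝ) < cfA α (j + 1) := by exact_mod_cast one_le_cfA hirr j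
        exact (Real.log_le_iff_le_exp h2).2 h1
      calc ∑ j ∈ Finset.range n, (cfQ α (j + 1) : ℝ) * (10 + 6 * Real.log (cfA α (j + 1)))
          ≤ ∑ j ∈ Finset.range n, (cfQ α (j + 1) : ℝ) * (10 + 6 * (c * (n - j))) :=
            Finset.sum_le_sum fun j hj => by
              have := hlog j hj
              gcongr
        _ = 10 * ∑ j ∈ Finset.range n, (cfQ α (j + 1) : ℝ)
            + 6 * c * ∑ j ∈ Finset.range n, (cfQ α (j + 1) : ℝ) * (n - j) := by
            rw [Finset.mul_sum, Finset.mul_sum, ← Finset.sum_add_distrib]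
            exact Finset.sum_congr rfl fun j _ => by ring
        _ ≤ 10 * (3 * cfQ α n) + 6 * c * (9 * cfQ α n) := by
            gcongr
            · exact sum_cfQ_le hirr n
            · exact sum_cfQ_mul_le hirr n
        _ = (30 + 54 * c) * cfQ α n := by ring
  refine ⟨44 + (30 + 54 * c), by positivity, fun k v w hvw b _ => ?_⟩
  have hC := hmid k v w hvw
  obtain ⟨hv0, hw1, -, -⟩ := hvw.exists_eq
  constructor
  · rintro x ⟨hx, hxb⟩
    refine ⟨⟨⟨hv0.trans hx.1.le, hx.2.trans_le hw1⟩, ?_⟩, hx⟩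
    have htri := abs_sub_le (birkhoffRot α symLog (cfQ α (nk k)) x)
      (birkhoffRot α symLog (cfQ α (nk k)) (1 / (2 * (cfQ α (nk k) : ℝ))))
      (birkhoffRot α symLog (cfQ α (nk k)) ((v + w) / 2))
    rw [abs_sub_comm (birkhoffRot α symLog (cfQ α (nk k)) (1 / (2 * (cfQ α (nk k) : ℝ))))] at htri
    linarith
  · rintro x ⟨⟨-, hxb⟩, hx⟩
    refine ⟨hx, ?_⟩
    have htri := abs_sub_le (birkhoffRot α symLog (cfQ α (nk k)) x)
      (birkhoffRot α symLog (cfQ α (nk k)) ((v + w) / 2))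
      (birkhoffRot α symLog (cfQ α (nk k)) (1 / (2 * (cfQ α (nk k) : ℝ))))
    linarith
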